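/- A finite meet-semilattice M = (M, ∧) has Property SDC for the clone [∧] if and only if M is distributive, equivalently, if and only if M has a greatest element and the lattice obtained from M by defining x ∨ y as the meet of all common upper bounds of x and y is a distributive lattice. -/

import Mathlib

/-- A family of finitary operations on `A`, indexed by arity. -/
abbrev OpFamily (A : Type*) := ∀ n : ℕ, Set ((Fin n → A) → A)

/-- `C` is a clone: it contains all projections and is closed under composition. -/
def IsClone {A : Type*} (C : OpFamily A) : Prop :=
  (∀ (n : ℕ) (i : Fin n), (fun x : Fin n → A => x i) ∈ C n) ∧
  (∀ (n k : ℕ) (f : (Fin n → A) → A) (g : Fin n → (Fin k → A) → A),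
    f ∈ C n → (∀ i, g i ∈ C k) → (fun x => f (fun i => g i x)) ∈ C k)

/-- `f` and `g` commute. -/
def Commutes {A : Type*} {n m : ℕ} (f : (Fin n → A) → A) (g : (Fin m → A) → A) : Prop :=
  ∀ M : Fin n → Fin m → A,
    f (fun i => g (M i)) = g (fun j => f (fun i => M i j))

/-- The centralizer `F*` of a family of operations. -/
def Centralizer {A : Type*} (F : OpFamily A) : OpFamily A :=
  fun m => {g | ∀ (n : ℕ) (f : (Fin n → A) → A), f ∈ F n → Commutes f g}

/-- `T ⊆ A^n` is closed under the family of operations `D`. -/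
def ClosedUnder {A : Type*} (D : OpFamily A) {n : ℕ} (T : Set (Fin n → A)) : Prop :=
  ∀ (m : ℕ) (h : (Fin m → A) → A), h ∈ D m →
    ∀ t : Fin m → (Fin n → A), (∀ j, t j ∈ T) →
      (fun i => h (fun j => t j i)) ∈ T

/-- `T` is the solution set of a (finite) system of `C`-equations in `n` variables. -/
def IsSolutionSet {A : Type*} (C : OpFamily A) (n : ℕ) (T : Set (Fin n → A)) : Prop :=
  ∃ (t : ℕ) (f g : Fin t → ((Fin n → A) → A)),
    (∀ i, f i ∈ C n) ∧ (∀ i, g i ∈ C n) ∧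
    T = {a | ∀ i, f i a = g i a}

/-- Property SDC: solution sets of systems of `C`-equations are exactly
the sets closed under the centralizer of `C`. -/
def HasSDC {A : Type*} (C : OpFamily A) : Prop :=
  ∀ (n : ℕ) (T : Set (Fin n → A)),
    IsSolutionSet C n T ↔ ClosedUnder (Centralizer C) T

/-- A family of relations on `A`, indexed by arity. -/
abbrev RelFamily (A : Type*) := ∀ h : ℕ, Set (Set (Fin h → A))

/-- `C∘`: the relations that are solution sets of a single `C`-equation. -/
def SolRels {A : Type*} (C : OpFamily A) : RelFamily A :=
  fun h => {ρ | ∃ f g, f ∈ C h ∧ g ∈ C h ∧ ρ = {a | f a = g a}}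

/-- `C•`: the graphs of the members of `C`. -/
def GraphRels {A : Type*} (C : OpFamily A) : RelFamily A :=
  fun h => {ρ | ∃ (n : ℕ) (e : n + 1 = h) (f : (Fin n → A) → A), f ∈ C n ∧
    ρ = {a | f (fun i => a (Fin.cast e i.castSucc)) = a (Fin.cast e (Fin.last n))}}

/-- `T ∈ ⟨R⟩∃`: `T` is definable by a primitive positive formula over `R ∪ {=}`,
with free variables `x_1,…,x_n` and quantified variables `y_1,…,y_m`. -/
def PPDef {A : Type*} (R : RelFamily A) (n : ℕ) (T : Set (Fin n → A)) : Prop :=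
  ∃ (m t : ℕ) (r : Fin t → ℕ) (ρ : ∀ j, Set (Fin (r j) → A))
    (z : ∀ j, Fin (r j) → Fin (n + m))
    (s : ℕ) (e₁ e₂ : Fin s → Fin (n + m)),
    (∀ j, ρ j ∈ R (r j)) ∧
    T = {x | ∃ y : Fin m → A,
          (∀ j, (fun i => Fin.append x y (z j i)) ∈ ρ j) ∧
          (∀ k, Fin.append x y (e₁ k) = Fin.append x y (e₂ k))}

/-- `T ∈ ⟨R⟩∄`: `T` is definable by a quantifier-free primitive positive formula
over `R ∪ {=}`. -/
def QFPPDef {A : Type*} (R : RelFamily A) (n : ℕ) (T : Set (Fin n → A)) : Prop :=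
  ∃ (t : ℕ) (r : Fin t → ℕ) (ρ : ∀ j, Set (Fin (r j) → A))
    (z : ∀ j, Fin (r j) → Fin n)
    (s : ℕ) (e₁ e₂ : Fin s → Fin n),
    (∀ j, ρ j ∈ R (r j)) ∧
    T = {x | (∀ j, (fun i => x (z j i)) ∈ ρ j) ∧ (∀ k, x (e₁ k) = x (e₂ k))}

/-- `g` preserves the relation `ρ`. -/
def Preserves {A : Type*} {m h : ℕ} (g : (Fin m → A) → A) (ρ : Set (Fin h → A)) : Prop :=
  ∀ t : Fin m → (Fin h → A), (∀ j, t j ∈ ρ) → (fun i => g (fun j => t j i)) ∈ ρ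

/-- `ρ ∈ Inv(F)`: every member of `F` preserves `ρ`. -/
def MemInv {A : Type*} (F : OpFamily A) {h : ℕ} (ρ : Set (Fin h → A)) : Prop :=
  ∀ (m : ℕ) (g : (Fin m → A) → A), g ∈ F m → Preserves g ρ

/-- The clone `[∧, ∨]` generated by the lattice operations: all lattice term operations. -/
inductive LatticeTerm (L : Type*) [Lattice L] : ∀ n : ℕ, ((Fin n → L) → L) → Prop
  | proj {n : ℕ} (i : Fin n) : LatticeTerm L n (fun x => x i)
  | inf {n : ℕ} {f g : (Fin n → L) → L} :
      LatticeTerm L n f → LatticeTerm L n g → LatticeTerm L n (fun x => f x ⊓ g x)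
  | sup {n : ℕ} {f g : (Fin n → L) → L} :
      LatticeTerm L n f → LatticeTerm L n g → LatticeTerm L n (fun x => f x ⊔ g x)

/-- The clone `[∧, ∨]` as an `OpFamily`. -/
def LatticeClone (L : Type*) [Lattice L] : OpFamily L :=
  fun n f => LatticeTerm L n f

/-- The clone `[∧]` generated by the meet operation: all nonempty meets of variables. -/
inductive MeetTerm (M : Type*) [SemilatticeInf M] : ∀ n : ℕ, ((Fin n → M) → M) → Prop
  | proj {n : ℕ} (i : Fin n) : MeetTerm M n (fun x => x i)
  | inf {n : ℕ} {f g : (Fin n → M) → M} :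
      MeetTerm M n f → MeetTerm M n g → MeetTerm M n (fun x => f x ⊓ g x)

/-- The clone `[∧]` as an `OpFamily`. -/
def MeetClone (M : Type*) [SemilatticeInf M] : OpFamily M :=
  fun n f => MeetTerm M n f

section helpers

variable {M : Type*} [SemilatticeInf M]

theorem meet_hom_mem {m : ℕ} {h : (Fin m → M) → M}
    (hh : ∀ x y, h (fun j => x j ⊓ y j) = h x ⊓ h y) :
    h ∈ Centralizer (MeetClone M) m := by
  intro n f hf
  have hf' : MeetTerm M n f := hf
  induction hf' with
  | proj i => intro _; rfl
  | inf h1 h2 ih1 ih2 =>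
    intro N
    have e1 := ih1 h1 N
    have e2 := ih2 h2 N
    simp only [e1, e2, hh]

theorem mem_meet_hom {m : ℕ} {h : (Fin m → M) → M}
    (hm : h ∈ Centralizer (MeetClone M) m) (x y : Fin m → M) :
    h (fun j => x j ⊓ y j) = h x ⊓ h y := by
  have := hm 2 (fun v => v 0 ⊓ v 1) (MeetTerm.inf (MeetTerm.proj 0) (MeetTerm.proj 1)) ![x, y]
  simpa using this.symm

theorem mem_mono {m : ℕ} {h : (Fin m → M) → M}
    (hm : h ∈ Centralizer (MeetClone M) m) {x y : Fin m → M} (hxy : ∀ j, x j ≤ y j) :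
    h x ≤ h y := by
  have := mem_meet_hom hm x y
  have e : (fun j => x j ⊓ y j) = x := by
    funext j; exact inf_eq_left.2 (hxy j)
  rw [e] at this
  exact inf_eq_left.1 this.symm

theorem sol_closed {n : ℕ} {T : Set (Fin n → M)} (hT : IsSolutionSet (MeetClone M) n T) :
    ClosedUnder (Centralizer (MeetClone M)) T := by
  obtain ⟨t, f, g, hf, hg, rfl⟩ := hT
  intro m h hh x hx i
  have e1 := hh n (f i) (hf i) (fun i j => x j i)
  have e2 := hh n (g i) (hg i) (fun i j => x j i)
  rw [e1, e2]
  congr 1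
  funext j
  exact hx j i

open Classical in
theorem term_ind {n : ℕ} {f : (Fin n → M) → M} (hf : MeetTerm M n f) {b c : M} (hb : ∀ x, b ≤ x)
    (p : M) (v : Fin n → M) :
    f (fun i => if p ≤ v i then c else b) = if p ≤ f v then c else b := by
  induction hf with
  | proj i => rfl
  | inf h1 h2 ih1 ih2 =>
    simp only [ih1, ih2, le_inf_iff]
    split_ifs <;> simp_all

open Classical in
theorem sdc_mem (H : HasSDC (MeetClone M)) {b c : M} (hb : ∀ x, b ≤ x) (hc : c ≠ b)
    {n : ℕ} {T : Set (Fin n → M)} (hT : ClosedUnder (Centralizer (MeetClone M)) T)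
    (v : Fin n → M) (hv : ∀ p, (fun i => if p ≤ v i then c else b) ∈ T) : v ∈ T := by
  obtain ⟨t, f, g, hf, hg, rfl⟩ := (H n T).2 hT
  intro i
  have key : ∀ p, p ≤ f i v ↔ p ≤ g i v := by
    intro p
    have := hv p i
    rw [term_ind (hf i) hb, term_ind (hg i) hb] at this
    by_cases h1 : p ≤ f i v <;> by_cases h2 : p ≤ g i v <;> simp_all
  exact le_antisymm ((key _).1 le_rfl) ((key _).2 le_rfl)

theorem term_inf' {n : ℕ} (I : Finset (Fin n)) (hI : I.Nonempty) :
    MeetTerm M n (fun x => I.inf' hI x) := by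
  induction hI using Finset.Nonempty.cons_induction with
  | singleton a => simpa using MeetTerm.proj a
  | cons a s ha hs ih =>
    have := MeetTerm.inf (MeetTerm.proj a) ih
    convert this using 2 with x
    exact Finset.inf'_cons hs _

theorem sol_of_finite {n : ℕ} {ι : Type} [Finite ι] (f g : ι → (Fin n → M) → M)
    (hf : ∀ i, MeetTerm M n (f i)) (hg : ∀ i, MeetTerm M n (g i)) :
    IsSolutionSet (MeetClone M) n {a | ∀ i, f i a = g i a} := by
  obtain ⟨t, ⟨e⟩⟩ := Finite.exists_equiv_fin ι
  refine ⟨t, fun i => f (e.symm i), fun i => g (e.symm i), fun i => hf _, fun i => hg _, ?_⟩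
  ext a
  exact ⟨fun h i => h _, fun h i => by simpa using h (e i)⟩

theorem exists_bot' [Fintype M] [Nonempty M] : ∃ b : M, ∀ x, b ≤ x :=
  ⟨Finset.univ.inf' Finset.univ_nonempty id, fun x => Finset.inf'_le id (Finset.mem_univ x)⟩

theorem sdc_directed (H : HasSDC (MeetClone M)) {b c : M} (hb : ∀ x, b ≤ x) (hc : c ≠ b)
    (x y : M) : ∃ z, x ≤ z ∧ y ≤ z := by
  have hT : ClosedUnder (Centralizer (MeetClone M))
      {v : Fin 2 → M | ∃ z, v 0 ≤ z ∧ v 1 ≤ z} := by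
    intro m h hh t ht
    choose z hz1 hz2 using ht
    exact ⟨h z, mem_mono hh hz1, mem_mono hh hz2⟩
  have := sdc_mem H hb hc hT ![x, y] (by
    intro p
    refine ⟨c, ?_, ?_⟩ <;> dsimp only <;> split_ifs <;> simp [hb])
  simpa using this

open Classical in
theorem sdc_distrib (H : HasSDC (MeetClone M)) {b c : M} (hb : ∀ x, b ≤ x) (hc : c ≠ b)
    (a b₀ b₁ : M) (hab : b₀ ⊓ b₁ ≤ a) :
    ∃ a₀ a₁ : M, b₀ ≤ a₀ ∧ b₁ ≤ a₁ ∧ a = a₀ ⊓ a₁ := by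
  have hT : ClosedUnder (Centralizer (MeetClone M))
      {v : Fin 3 → M | ∃ a₀ a₁ : M, v 1 ≤ a₀ ∧ v 2 ≤ a₁ ∧ v 0 = a₀ ⊓ a₁} := by
    intro m h hh t ht
    choose z w hz1 hz2 hz3 using ht
    refine ⟨h z, h w, mem_mono hh hz1, mem_mono hh hz2, ?_⟩
    rw [← mem_meet_hom hh]
    exact congrArg h (funext hz3)
  have := sdc_mem H hb hc hT ![a, b₀, b₁] (by
    intro p
    have hp : p ≤ b₀ → p ≤ b₁ → p ≤ a := fun h1 h2 => (le_inf h1 h2).trans hab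
    simp only [Set.mem_ofPred_eq, Matrix.cons_val_zero, Matrix.cons_val_one, Matrix.cons_val]
    have ib : ∀ (q : Prop) {_d : Decidable q}, (if q then c else b) ≤ c := by
      intro q _
      split_ifs
      · exact le_rfl
      · exact hb _
    by_cases h1 : p ≤ b₀
    · by_cases h2 : p ≤ b₁
      · exact ⟨c, c, by simp [h1], by simp [h2], by simp [hp h1 h2]⟩
      · by_cases h3 : p ≤ a
        · exact ⟨c, c, by simp [h1], by simp [h2, hb], by simp [h3]⟩
        · exact ⟨c, b, by simp [h1], by simp [h2], by simp [h3, hb]⟩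
    · by_cases h3 : p ≤ a
      · exact ⟨c, c, by simp [h1, hb], by exact ib _, by simp [h3]⟩
      · exact ⟨b, c, by simp [h1], by exact ib _, by simp [h3, hb]⟩)
  simpa using this

theorem exists_lub [Fintype M] (hd : ∀ x y : M, ∃ z, x ≤ z ∧ y ≤ z) (x y : M) :
    ∃ z, IsLUB {x, y} z := by
  classical
  have hne : (Finset.univ.filter (fun z => x ≤ z ∧ y ≤ z)).Nonempty := by
    obtain ⟨z, hz⟩ := hd x y
    exact ⟨z, by simpa using hz⟩
  refine ⟨(Finset.univ.filter (fun z => x ≤ z ∧ y ≤ z)).inf' hne id, ?_, ?_⟩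
  · intro w hw
    refine Finset.le_inf' _ _ ?_
    intro z hz
    simp only [Finset.mem_filter, Finset.mem_univ, true_and] at hz
    rcases hw with rfl | rfl
    · exact hz.1
    · exact hz.2
  · intro w hw
    refine Finset.inf'_le id ?_
    simp only [Finset.mem_filter, Finset.mem_univ, true_and]
    exact ⟨hw (by simp), hw (by simp)⟩

theorem forward [Fintype M] [Nonempty M]
    (hD : ∀ a b₀ b₁ : M, b₀ ⊓ b₁ ≤ a → ∃ a₀ a₁ : M, b₀ ≤ a₀ ∧ b₁ ≤ a₁ ∧ a = a₀ ⊓ a₁)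
    (hd : ∀ x y : M, ∃ z, x ≤ z ∧ y ≤ z) :
    (∃ t : M, ∀ x : M, x ≤ t) ∧
        ∃ s : M → M → M, (∀ x y : M, IsLUB {x, y} (s x y)) ∧
          ∀ x y z : M, x ⊓ s y z = s (x ⊓ y) (x ⊓ z) := by
  constructor
  · obtain ⟨t, -, ht⟩ := (Set.finite_univ (α := M)).exists_maximal Set.univ_nonempty
    refine ⟨t, fun x => ?_⟩
    obtain ⟨z, h1, h2⟩ := hd x t
    exact h1.trans (ht (Set.mem_univ z) h2)
  · choose s hs using exists_lub hd
    refine ⟨s, hs, fun x y z => ?_⟩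
    have l : ∀ x y, x ≤ s x y := fun x y => (hs x y).1 (by simp)
    have r : ∀ x y, y ≤ s x y := fun x y => (hs x y).1 (by simp)
    have lub : ∀ {x y w}, x ≤ w → y ≤ w → s x y ≤ w := fun {x y w} h1 h2 =>
      (hs x y).2 (by rintro _ (rfl | rfl) <;> assumption)
    apply le_antisymm
    · obtain ⟨a₀, a₁, h1, h2, h3⟩ := hD _ _ _ (l (x ⊓ y) (x ⊓ z))
      have h4 : x ⊓ z ≤ a₁ := (r (x ⊓ y) (x ⊓ z)).trans (h3.le.trans inf_le_right)
      obtain ⟨c₀, c₁, h5, h6, h7⟩ := hD _ _ _ h4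
      have h8 : s y z ≤ c₁ := lub (h2.trans (h7.le.trans inf_le_right)) h6
      rw [h3]
      refine le_inf (inf_le_left.trans h1) ?_
      rw [h7]
      exact le_inf (inf_le_left.trans h5) (inf_le_right.trans h8)
    · exact lub (inf_le_inf_left _ (l _ _)) (inf_le_inf_left _ (r _ _))

end helpers

section dist

open Classical in
theorem dist_closed_sol {M : Type*} [DistribLattice M] [OrderBot M] [Fintype M] {n : ℕ}
    {T : Set (Fin n → M)} (hT : ClosedUnder (Centralizer (MeetClone M)) T) :
    IsSolutionSet (MeetClone M) n T := by
  let ι : Type := {p : {I : Finset (Fin n) // I.Nonempty} × Fin n //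
    ∀ x ∈ T, p.1.1.inf' p.1.2 x ≤ x p.2}
  have key := sol_of_finite (M := M) (ι := ι) (fun p x => p.1.1.1.inf' p.1.1.2 x)
    (fun p x => p.1.1.1.inf' p.1.1.2 x ⊓ x p.1.2)
    (fun p => term_inf' _ _) (fun p => MeetTerm.inf (term_inf' _ _) (MeetTerm.proj _))
  convert key using 1
  ext a
  simp only [Set.mem_ofPred_eq]
  constructor
  · intro ha p
    exact (inf_eq_left.2 (p.2 a ha)).symm
  · intro ha
    obtain ⟨m, ⟨e⟩⟩ := Finite.exists_equiv_fin T
    let t : Fin m → (Fin n → M) := fun j => (e.symm j).1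
    have ht : ∀ j, t j ∈ T := fun j => (e.symm j).2
    have ht' : ∀ x ∈ T, ∃ j, t j = x := fun x hx => ⟨e ⟨x, hx⟩, by simp [t]⟩
    let S : (Fin m → M) → Finset {I : Finset (Fin n) // I.Nonempty} := fun x =>
      Finset.univ.filter (fun I => ∀ j, I.1.inf' I.2 (t j) ≤ x j)
    let h : (Fin m → M) → M := fun x => (S x).sup (fun I => I.1.inf' I.2 a)
    have hmono : ∀ x y, (∀ j, x j ≤ y j) → h x ≤ h y := by
      intro x y hxy
      refine Finset.sup_mono ?_
      intro I hI
      simp only [S, Finset.mem_filter, Finset.mem_univ, true_and] at hI ⊢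
      exact fun j => (hI j).trans (hxy j)
    have hh : h ∈ Centralizer (MeetClone M) m := by
      apply meet_hom_mem
      intro x y
      apply le_antisymm
      · exact le_inf (hmono _ _ fun j => inf_le_left) (hmono _ _ fun j => inf_le_right)
      · simp only [h]
        rw [Finset.sup_inf_sup]
        refine Finset.sup_le ?_
        rintro ⟨I, J⟩ hIJ
        simp only [S, Finset.mem_product, Finset.mem_filter, Finset.mem_univ, true_and] at hIJ
        have hne : (I.1 ∪ J.1).Nonempty := I.2.mono Finset.subset_union_left
        have : (⟨I.1 ∪ J.1, hne⟩ : {I : Finset (Fin n) // I.Nonempty}) ∈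
            S (fun j => x j ⊓ y j) := by
          simp only [S, Finset.mem_filter, Finset.mem_univ, true_and]
          intro j
          rw [Finset.inf'_union I.2 J.2]
          exact inf_le_inf (hIJ.1 j) (hIJ.2 j)
        refine le_trans ?_ (Finset.le_sup (f := fun I : {I : Finset (Fin n) // I.Nonempty} =>
          I.1.inf' I.2 a) this)
        simp only
        rw [Finset.inf'_union I.2 J.2]
    have := hT m h hh t ht
    convert this using 1
    funext i
    apply le_antisymm
    · have hi : (⟨{i}, by simp⟩ : {I : Finset (Fin n) // I.Nonempty}) ∈ S (fun j => t j i) := by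
        simp [S]
      refine le_trans ?_ (Finset.le_sup (f := fun I : {I : Finset (Fin n) // I.Nonempty} =>
          I.1.inf' I.2 a) hi)
      simp
    · refine Finset.sup_le ?_
      intro I hI
      simp only [S, Finset.mem_filter, Finset.mem_univ, true_and] at hI
      have := ha ⟨(I, i), by
        intro x hx
        obtain ⟨j, rfl⟩ := ht' x hx
        exact hI j⟩
      exact inf_eq_left.1 this.symm

theorem backward {M : Type*} [inst : SemilatticeInf M] [Fintype M] [Nonempty M]
    (s : M → M → M) (hs : ∀ x y : M, IsLUB {x, y} (s x y))
    (hd : ∀ x y z : M, x ⊓ s y z = s (x ⊓ y) (x ⊓ z)) : HasSDC (MeetClone M) := by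
  obtain ⟨b, hb⟩ := exists_bot' (M := M)
  letI L : Lattice M := { inst with
    sup := s
    le_sup_left := fun x y => (hs x y).1 (by simp)
    le_sup_right := fun x y => (hs x y).1 (by simp)
    sup_le := fun x y w h1 h2 => (hs x y).2 (by rintro _ (rfl | rfl) <;> assumption) }
  letI D : DistribLattice M := DistribLattice.ofInfSupLe (fun x y z => (hd x y z).le)
  letI B : OrderBot M := { bot := b, bot_le := hb }
  intro n T
  exact ⟨sol_closed, fun h => dist_closed_sol h⟩

end dist

/-- a finite meet-semilattice has Property SDC for `[∧]` iff it
is distributive; equivalently, iff it has a greatest element and binary joins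
exist making it a distributive lattice. -/
theorem stmt_17 {M : Type*} [SemilatticeInf M] [Fintype M] [Nonempty M] :
    HasSDC (MeetClone M) ↔
      ((∀ a b₀ b₁ : M, b₀ ⊓ b₁ ≤ a →
          ∃ a₀ a₁ : M, b₀ ≤ a₀ ∧ b₁ ≤ a₁ ∧ a = a₀ ⊓ a₁) ∧
        (∃ t : M, ∀ x : M, x ≤ t) ∧
        ∃ s : M → M → M, (∀ x y : M, IsLUB {x, y} (s x y)) ∧
          ∀ x y z : M, x ⊓ s y z = s (x ⊓ y) (x ⊓ z)) := by
  constructor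
  · intro H
    obtain ⟨b, hb⟩ := exists_bot' (M := M)
    by_cases hc : ∃ c : M, c ≠ b
    · obtain ⟨c, hc⟩ := hc
      have hD := sdc_distrib H hb hc
      exact ⟨hD, forward hD (sdc_directed H hb hc)⟩
    · push Not at hc
      have hD : ∀ a b₀ b₁ : M, b₀ ⊓ b₁ ≤ a →
          ∃ a₀ a₁ : M, b₀ ≤ a₀ ∧ b₁ ≤ a₁ ∧ a = a₀ ⊓ a₁ := fun a b₀ b₁ _ =>
        ⟨b, b, (hc _).le, (hc _).le, by rw [hc a, inf_idem]⟩
      exact ⟨hD, forward hD fun x y => ⟨b, (hc _).le, (hc _).le⟩⟩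
  · rintro ⟨-, -, s, hs, hd⟩
    exact backward s hs hd
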